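/- arXiv:1204.2132 — 4 statements merged into one kernel-verified Lean document; each statement's English description precedes it below -/
import Mathlib

section
/- For every positive integer n, the sum over all integers j ∈ ℤ of exp(-n·e^{-|j|/n})·e^{-|j|/n} is at most 3. -/
/-- `exp (-n e^{-x/n}) e^{-x/n}` is controlled by a forward difference of
`x ↦ exp (-n e^{-x/n})`. -/
theorem exp_neg_mul_exp_mul_exp_le_sub {n : ℝ} (hn : 0 < n) (x : ℝ) :
    Real.exp (-n * Real.exp (-x / n)) * Real.exp (-x / n) ≤
      (n + 1) / n * (Real.exp (-n * Real.exp (-(x + 1) / n)) -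
        Real.exp (-n * Real.exp (-x / n))) := by
  set u := Real.exp (-x / n) with hu
  have hu0 : 0 < u := Real.exp_pos _
  have hr : Real.exp (-(1 / n)) ≤ n / (n + 1) := by
    rw [Real.exp_neg, inv_le_comm₀ (Real.exp_pos _) (by positivity)]
    have h := Real.add_one_le_exp (1 / n)
    have h' : (n / (n + 1))⁻¹ = 1 / n + 1 := by field_simp; ring
    rwa [h']
  have hstep : Real.exp (-(x + 1) / n) = u * Real.exp (-(1 / n)) := by
    rw [hu, ← Real.exp_add]
    congr 1
    ring
  have hle : -n * u + n / (n + 1) * u ≤ -n * Real.exp (-(x + 1) / n) := by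
    have h : n * u * Real.exp (-(1 / n)) ≤ n * u * (n / (n + 1)) := by gcongr
    have h' : -n * u + n / (n + 1) * u = -(n * u * (n / (n + 1))) := by field_simp; ring
    rw [hstep, h']
    linarith
  have hexp : Real.exp (-n * u) * (n / (n + 1) * u + 1) ≤
      Real.exp (-n * Real.exp (-(x + 1) / n)) := by
    refine le_trans ?_ (Real.exp_le_exp.mpr hle)
    rw [Real.exp_add]
    gcongr
    exact Real.add_one_le_exp _
  calc Real.exp (-n * u) * u
      = (n + 1) / n * (Real.exp (-n * u) * (n / (n + 1) * u + 1) - Real.exp (-n * u)) := by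
        field_simp; ring
    _ ≤ _ := by gcongr

theorem sum_range_exp_neg_mul_exp_mul_exp_le {n : ℝ} (hn : 0 < n) {s : ℝ} (hs : 0 ≤ s) (N : ℕ) :
    ∑ i ∈ Finset.range N, Real.exp (-n * Real.exp (-(i + s) / n)) * Real.exp (-(i + s) / n) ≤
      (n + 1) / n * (1 - Real.exp (-n)) := by
  have htele : ∑ i ∈ Finset.range N,
      Real.exp (-n * Real.exp (-(i + s) / n)) * Real.exp (-(i + s) / n) ≤
      (n + 1) / n * (Real.exp (-n * Real.exp (-(N + s) / n)) -
        Real.exp (-n * Real.exp (-s / n))) := by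
    induction N with
    | zero => simp
    | succ N ih =>
      rw [Finset.sum_range_succ]
      have h := exp_neg_mul_exp_mul_exp_le_sub hn (N + s)
      have hN : ((N + 1 : ℕ) : ℝ) + s = N + s + 1 := by push_cast; ring
      rw [hN]
      linarith
  refine htele.trans ?_
  gcongr
  · exact Real.exp_le_one_iff.mpr (by nlinarith [Real.exp_pos (-(N + s) / n)])
  · have h : Real.exp (-s / n) ≤ 1 :=
      Real.exp_le_one_iff.mpr (div_nonpos_of_nonpos_of_nonneg (by linarith) hn.le)
    nlinarith

theorem add_one_div_mul_one_sub_exp_neg_le {n : ℕ} (hn : 0 < n) :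
    ((n : ℝ) + 1) / n * (1 - Real.exp (-(n : ℝ))) ≤ 3 / 2 := by
  obtain rfl | h2 : n = 1 ∨ 2 ≤ n := by omega
  · have h : (1 / 4 : ℝ) ≤ Real.exp (-1) := by
      rw [Real.exp_neg, one_div]
      exact inv_anti₀ (Real.exp_pos 1) (by linarith [Real.exp_one_lt_d9])
    norm_num
    linarith
  · have h2' : (2 : ℝ) ≤ n := by exact_mod_cast h2
    have hc : ((n : ℝ) + 1) / n ≤ 3 / 2 := by
      rw [div_le_iff₀ (by linarith)]
      linarith
    have hc0 : 0 ≤ ((n : ℝ) + 1) / n := by positivity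
    nlinarith [Real.exp_pos (-(n : ℝ))]

theorem tsum_a_exp_le_three (n : ℕ) (hn : 0 < n) :
    ∑' j : ℤ, Real.exp (-(n : ℝ) * Real.exp (-|(j : ℝ)| / n)) * Real.exp (-|(j : ℝ)| / n)
      ≤ 3 := by
  have hn' : (0 : ℝ) < n := by exact_mod_cast hn
  have hbound {s : ℝ} (hs : 0 ≤ s) (N : ℕ) :=
    (sum_range_exp_neg_mul_exp_mul_exp_le hn' hs N).trans (add_one_div_mul_one_sub_exp_neg_le hn)
  have hsum {s : ℝ} (hs : 0 ≤ s) : Summable fun i : ℕ =>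
      Real.exp (-(n : ℝ) * Real.exp (-(i + s) / n)) * Real.exp (-(i + s) / n) :=
    summable_of_sum_range_le (fun _ => by positivity) (hbound hs)
  have htsum {s : ℝ} (hs : 0 ≤ s) : ∑' i : ℕ,
      Real.exp (-(n : ℝ) * Real.exp (-(i + s) / n)) * Real.exp (-(i + s) / n) ≤ 3 / 2 :=
    Real.tsum_le_of_sum_range_le (fun _ => by positivity) (hbound hs)
  have hnat (i : ℕ) : |((i : ℤ) : ℝ)| = i + 0 := by simp
  have hneg (i : ℕ) : |((-((i : ℤ) + 1) : ℤ) : ℝ)| = i + 1 := by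
    push_cast
    rw [abs_neg, abs_of_nonneg (by positivity)]
  rw [tsum_of_nat_of_neg_add_one]
  · simp only [hnat, hneg]
    linarith [htsum le_rfl, htsum zero_le_one]
  · simpa only [hnat] using hsum le_rfl
  · simpa only [hneg] using hsum zero_le_one
end

section
/- Let g be a bijection of ℤ with w(g) := sup_j |g(j) - j| finite. Then for all positive integers n and all j ∈ ℤ, a_{n,g(j)}/a_{n,j} = exp(e^{-|j|/n}·(|g(j)| - |j| + η)) for some real η with |η| ≤ e^{w(g)}/n. -/
/-- `a n j = exp (-n e^{-|j|/n})`. -/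
noncomputable def a (n : ℕ) (j : ℤ) : ℝ :=
  Real.exp (-(n : ℝ) * Real.exp (-|(j : ℝ)| / n))

theorem two_mul_exp_sub_one_sub_le_sq {t : ℝ} (ht : 0 ≤ t) :
    2 * (Real.exp t - 1 - t) ≤ (Real.exp t - 1) ^ 2 := by
  have hderiv (x : ℝ) :
      HasDerivAt (fun x => (Real.exp x - 1) ^ 2 - 2 * (Real.exp x - 1 - x))
        (2 * (Real.exp x - 1) ^ 2) x := by
    have h := (Real.hasDerivAt_exp x).sub_const 1
    refine ((h.fun_pow 2).fun_sub ((h.fun_sub (hasDerivAt_id' x)).const_mul 2)).congr_deriv ?_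
    norm_num
    ring
  have hmono : Monotone (fun x => (Real.exp x - 1) ^ 2 - 2 * (Real.exp x - 1 - x)) :=
    monotone_of_deriv_nonneg (fun x => (hderiv x).differentiableAt) fun x => by
      rw [(hderiv x).deriv]
      positivity
  have h := hmono ht
  norm_num at h
  linarith

theorem sq_mul_exp_sub_one_sub_le {t : ℝ} (ht : 0 ≤ t) (n : ℕ) :
    (n : ℝ) ^ 2 * (Real.exp t - 1 - t) ≤ Real.exp (n * t) - 1 - n * t := by
  induction n with
  | zero => simp
  | succ n ih =>
    have hsq := two_mul_exp_sub_one_sub_le_sq ht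
    have hu : 0 ≤ Real.exp t - 1 - t := by linarith [Real.add_one_le_exp t]
    have hexp : Real.exp (((n + 1 : ℕ) : ℝ) * t) = Real.exp (n * t) * Real.exp t := by
      rw [← Real.exp_add]
      push_cast
      ring_nf
    rw [hexp]
    obtain ⟨u, hu_def⟩ : ∃ u, u = Real.exp t - 1 - t := ⟨_, rfl⟩
    have het : Real.exp t = 1 + t + u := by linarith
    rw [← hu_def] at hu ih hsq ⊢
    rw [het] at hsq ⊢
    have hstep : (1 + n * t + n ^ 2 * u) * (1 + t + u) ≤ Real.exp (n * t) * (1 + t + u) :=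
      mul_le_mul_of_nonneg_right (by linarith) (by positivity)
    have hn : 0 ≤ (n : ℝ) * (n - 1) := by
      rcases n with _ | m
      · simp
      · push_cast
        rw [add_sub_cancel_right]
        positivity
    have hlin : 0 ≤ (n : ℝ) * ((1 + t + u - 1) ^ 2 - 2 * u) :=
      mul_nonneg n.cast_nonneg (by linarith)
    have hquad : 0 ≤ (n : ℝ) * (n - 1) * (t * u + u ^ 2) := mul_nonneg hn (by positivity)
    push_cast
    linarith

theorem exp_sub_one_sub_le_abs (x : ℝ) :
    Real.exp x - 1 - x ≤ Real.exp |x| - 1 - |x| := by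
  rcases le_total 0 x with hx | hx
  · rw [abs_of_nonneg hx]
  · rw [abs_of_nonpos hx]
    have h := Real.self_le_sinh_iff.2 (neg_nonneg.2 hx)
    rw [Real.sinh_eq, neg_neg] at h
    linarith

theorem ratio_a_eq_exp (g : Equiv.Perm ℤ) (w : ℝ) (hw : ∀ j : ℤ, |(g j : ℝ) - j| ≤ w)
    (n : ℕ) (hn : 0 < n) (j : ℤ) :
    ∃ η : ℝ, |η| ≤ Real.exp w / n ∧
      a n (g j) / a n j
        = Real.exp (Real.exp (-|(j : ℝ)| / n) * (|(g j : ℝ)| - |(j : ℝ)| + η)) := by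
  have hn' : (0 : ℝ) < n := Nat.cast_pos.2 hn
  obtain ⟨x, hx⟩ : ∃ x : ℝ, x = (|(j : ℝ)| - |(g j : ℝ)|) / n := ⟨_, rfl⟩
  have hnx : n * x = |(j : ℝ)| - |(g j : ℝ)| := by rw [hx]; field_simp
  have hnw : n * |x| ≤ w := by
    rw [← abs_of_pos hn', ← abs_mul, hnx, abs_sub_comm]
    exact (abs_abs_sub_abs_le _ _).trans (hw j)
  have hnonneg : 0 ≤ Real.exp x - 1 - x := by linarith [Real.add_one_le_exp x]
  refine ⟨-(n * (Real.exp x - 1 - x)), ?_, ?_⟩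
  · rw [abs_neg, abs_of_nonneg (by positivity), le_div_iff₀ hn']
    calc n * (Real.exp x - 1 - x) * n = (n : ℝ) ^ 2 * (Real.exp x - 1 - x) := by ring
      _ ≤ (n : ℝ) ^ 2 * (Real.exp |x| - 1 - |x|) := by
        gcongr ?_ * ?_
        exact exp_sub_one_sub_le_abs x
      _ ≤ Real.exp (n * |x|) - 1 - n * |x| := sq_mul_exp_sub_one_sub_le (abs_nonneg x) n
      _ ≤ Real.exp (n * |x|) := by linarith [mul_nonneg hn'.le (abs_nonneg x)]
      _ ≤ Real.exp w := Real.exp_le_exp.2 hnw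
  · have hexp : Real.exp (-|(g j : ℝ)| / n) = Real.exp (-|(j : ℝ)| / n) * Real.exp x := by
      rw [← Real.exp_add, hx]
      ring_nf
    rw [a, a, ← Real.exp_sub, hexp]
    congr 1
    linear_combination -Real.exp (-|(j : ℝ)| / n) * hnx
end

section
/- Let g be a bijection of ℤ with bounded displacement and a_{n,j} = exp(-n·e^{-|j|/n}). Then Σ_{j∈ℤ} (a_{n,j}²/(1+a_{n,j}²))·(a_{n,g(j)}/a_{n,j} - 1) → 0 as n → ∞. -/
open Filter

theorem hasSum_int_pow_natAbs {q : ℝ} (h0 : 0 ≤ q) (h1 : q < 1) :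
    HasSum (fun j : ℤ => q ^ j.natAbs) ((1 - q)⁻¹ + q * (1 - q)⁻¹) := by
  have h := hasSum_geometric_of_lt_one h0 h1
  refine HasSum.of_nat_of_neg_add_one (by simpa using h) ?_
  have e : (fun m : ℕ => q ^ (-((m : ℤ) + 1)).natAbs) = fun m => q * q ^ m := by
    funext m
    rw [← pow_succ']
    congr 1
  rw [e]
  exact h.mul_left q

theorem exp_neg_abs_div_eq_pow (n : ℝ) (j : ℤ) :
    Real.exp (-|(j : ℝ)| / n) = Real.exp (-1 / n) ^ j.natAbs := by
  rw [← Real.exp_nat_mul, Nat.cast_natAbs, Int.cast_abs]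
  congr 1
  ring

theorem summable_exp_neg_abs_div {n : ℝ} (hn : 0 < n) :
    Summable (fun j : ℤ => Real.exp (-|(j : ℝ)| / n)) := by
  simp_rw [exp_neg_abs_div_eq_pow]
  exact (hasSum_int_pow_natAbs (Real.exp_pos _).le
    (Real.exp_lt_one_iff.mpr (div_neg_of_neg_of_pos (by norm_num) hn))).summable

theorem tsum_exp_neg_abs_div_le {n : ℝ} (hn : 0 < n) :
    ∑' j : ℤ, Real.exp (-|(j : ℝ)| / n) ≤ 2 * (n + 1) := by
  simp_rw [exp_neg_abs_div_eq_pow]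
  have hq : Real.exp (-1 / n) < 1 := Real.exp_lt_one_iff.mpr (div_neg_of_neg_of_pos (by norm_num) hn)
  have hq0 := Real.exp_pos (-1 / n)
  rw [(hasSum_int_pow_natAbs hq0.le hq).tsum_eq]
  have h1 : 1 / n + 1 ≤ (Real.exp (-1 / n))⁻¹ := by
    rw [← Real.exp_neg, neg_div, neg_neg]
    exact Real.add_one_le_exp _
  set q := Real.exp (-1 / n)
  have h2 : q * (n + 1) ≤ n := by
    have h3 := mul_le_mul_of_nonneg_left h1 hq0.le
    rw [mul_inv_cancel₀ hq0.ne'] at h3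
    have h4 := mul_le_mul_of_nonneg_right h3 hn.le
    field_simp at h4
    linarith
  have h5 : (1 - q)⁻¹ ≤ n + 1 := by
    rw [inv_le_iff_one_le_mul₀ (by linarith)]
    nlinarith
  have h6 : 0 < (1 - q)⁻¹ := inv_pos.2 (by linarith)
  nlinarith

theorem abs_half_log_one_add_sq_sub_le (x y : ℝ) :
    |x / (1 + x ^ 2) * (y - x) - (Real.log (1 + y ^ 2) / 2 - Real.log (1 + x ^ 2) / 2)|
      ≤ (y - x) ^ 2 := by
  have hX : 0 < 1 + x ^ 2 := by positivity
  have hY : 0 < 1 + y ^ 2 := by positivity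
  have hlog : Real.log ((1 + y ^ 2) / (1 + x ^ 2)) = Real.log (1 + y ^ 2) - Real.log (1 + x ^ 2) :=
    Real.log_div hY.ne' hX.ne'
  have hup := Real.log_le_sub_one_of_pos (div_pos hY hX)
  have hlo := Real.one_sub_inv_le_log_of_pos (div_pos hY hX)
  rw [hlog] at hup hlo
  rw [inv_div] at hlo
  have e1 : x / (1 + x ^ 2) * (y - x) - ((1 + y ^ 2) / (1 + x ^ 2) - 1) / 2
      = -((y - x) ^ 2 * (1 / (2 * (1 + x ^ 2)))) := by
    field_simp
    ring
  have e2 : x / (1 + x ^ 2) * (y - x) - (1 - (1 + x ^ 2) / (1 + y ^ 2)) / 2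
      = (y - x) ^ 2 * ((x * (x + 2 * y) - 1) / (2 * (1 + x ^ 2) * (1 + y ^ 2))) := by
    field_simp
    ring
  have b1 : 1 / (2 * (1 + x ^ 2)) ≤ 1 := by
    rw [div_le_one (by positivity)]
    nlinarith
  have b2 : (x * (x + 2 * y) - 1) / (2 * (1 + x ^ 2) * (1 + y ^ 2)) ≤ 1 := by
    rw [div_le_one (by positivity)]
    nlinarith [sq_nonneg (x - y), sq_nonneg (x * y)]
  have c1 := mul_le_mul_of_nonneg_left b1 (sq_nonneg (y - x))
  have c2 := mul_le_mul_of_nonneg_left b2 (sq_nonneg (y - x))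
  rw [abs_le]
  constructor <;> linarith

theorem Real.exp_sub_one_le_mul_exp (t : ℝ) : Real.exp t - 1 ≤ t * Real.exp t := by
  have h := mul_le_mul_of_nonneg_right (Real.add_one_le_exp (-t)) (Real.exp_pos t).le
  rw [← Real.exp_add, neg_add_cancel, Real.exp_zero] at h
  linarith

/-- The increment of `x ↦ exp (-n e^{-x/n})` is nonnegative and controlled by
`v e^{-v}`, where `v = n e^{-y/n}` belongs to the right endpoint. -/
theorem exp_neg_mul_exp_sub_le {n c x y : ℝ} (hn : 1 ≤ n) (hxy : x ≤ y) (hc : y - x ≤ c) :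
    0 ≤ Real.exp (-n * Real.exp (-y / n)) - Real.exp (-n * Real.exp (-x / n)) ∧
    Real.exp (-n * Real.exp (-y / n)) - Real.exp (-n * Real.exp (-x / n)) ≤ c * Real.exp c / n ∧
    Real.exp (-n * Real.exp (-y / n)) - Real.exp (-n * Real.exp (-x / n))
      ≤ c * Real.exp c * Real.exp (-y / n) := by
  have hn0 : 0 < n := by linarith
  have hc0 : 0 ≤ c := by linarith
  set t := (y - x) / n with ht
  have ht0 : 0 ≤ t := div_nonneg (by linarith) hn0.le
  have htc : t ≤ c / n := div_le_div_of_nonneg_right hc hn0.le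
  have htc' : t ≤ c := htc.trans (div_le_self hc0 hn)
  have hx : Real.exp (-x / n) = Real.exp (-y / n) * Real.exp t := by
    rw [← Real.exp_add, ht]
    congr 1
    ring
  have hE : Real.exp t - 1 ≤ c / n * Real.exp c :=
    (Real.exp_sub_one_le_mul_exp t).trans
      (mul_le_mul htc (Real.exp_le_exp.2 htc') (Real.exp_pos t).le (by positivity))
  have hE0 : 0 ≤ Real.exp t - 1 := by linarith [Real.add_one_le_exp t]
  have hw := Real.exp_pos (-y / n)
  set w := Real.exp (-y / n)
  have hfac : Real.exp (-n * (w * Real.exp t))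
      = Real.exp (-n * w) * Real.exp (-(n * w * (Real.exp t - 1))) := by
    rw [← Real.exp_add (-n * w)]
    congr 1
    ring
  rw [hx, hfac]
  have hv := Real.exp_pos (-n * w)
  have hpos : 0 ≤ n * w * (Real.exp t - 1) := by positivity
  have k1 : 1 - Real.exp (-(n * w * (Real.exp t - 1))) ≤ n * w * (Real.exp t - 1) := by
    linarith [Real.add_one_le_exp (-(n * w * (Real.exp t - 1)))]
  have k0 : 0 ≤ 1 - Real.exp (-(n * w * (Real.exp t - 1))) := by
    linarith [Real.exp_le_one_iff.2 (neg_nonpos.2 hpos)]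
  have k2 : Real.exp (-n * w) ≤ 1 := Real.exp_le_one_iff.2 (by nlinarith)
  have k3 : n * w * Real.exp (-n * w) ≤ 1 := by
    have h := mul_le_mul_of_nonneg_right (Real.add_one_le_exp (n * w)) hv.le
    rw [← Real.exp_add, neg_mul, add_neg_cancel, Real.exp_zero, ← neg_mul] at h
    linarith
  have k4 : Real.exp (-n * w) - Real.exp (-n * w) * Real.exp (-(n * w * (Real.exp t - 1)))
      ≤ n * w * Real.exp (-n * w) * (c / n * Real.exp c) := by
    calc _ = Real.exp (-n * w) * (1 - Real.exp (-(n * w * (Real.exp t - 1)))) := by ring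
      _ ≤ Real.exp (-n * w) * (n * w * (c / n * Real.exp c)) := by gcongr; exact k1.trans (by gcongr)
      _ = _ := by ring
  refine ⟨by nlinarith, k4.trans ?_, k4.trans ?_⟩
  · calc _ ≤ 1 * (c / n * Real.exp c) := by gcongr
      _ = _ := by ring
  · calc n * w * Real.exp (-n * w) * (c / n * Real.exp c)
        ≤ n * w * 1 * (c / n * Real.exp c) := by gcongr
      _ = _ := by field_simp

theorem abs_a_sub_a_le {n : ℕ} (hn : 1 ≤ n) {c : ℝ} {j k : ℤ} (h : |(k : ℝ) - j| ≤ c) :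
    |a n k - a n j| ≤ c * Real.exp c * Real.exp c / n ∧
    |a n k - a n j| ≤ c * Real.exp c * Real.exp c * Real.exp (-|(j : ℝ)| / n) := by
  have hn' : (1 : ℝ) ≤ n := by exact_mod_cast hn
  have hc : 0 ≤ c := (abs_nonneg _).trans h
  have hC : 0 ≤ c * Real.exp c := by positivity
  have hC' : c * Real.exp c ≤ c * Real.exp c * Real.exp c :=
    le_mul_of_one_le_right hC (Real.one_le_exp hc)
  have hkj := abs_le.1 ((abs_abs_sub_abs_le_abs_sub (k : ℝ) j).trans h)
  rcases le_total |(j : ℝ)| |(k : ℝ)| with hle | hle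
  · obtain ⟨h0, h1, h2⟩ := exp_neg_mul_exp_sub_le hn' hle (c := c) (by linarith)
    rw [a, a, abs_of_nonneg h0]
    refine ⟨h1.trans (by gcongr), h2.trans ?_⟩
    gcongr
  · obtain ⟨h0, h1, h2⟩ := exp_neg_mul_exp_sub_le hn' hle (c := c) (by linarith)
    rw [abs_sub_comm, a, a, abs_of_nonneg h0]
    refine ⟨h1.trans (by gcongr), h2.trans ?_⟩
    gcongr

theorem sq_a_sub_a_le {n : ℕ} (hn : 1 ≤ n) {c : ℝ} {j k : ℤ} (h : |(k : ℝ) - j| ≤ c) :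
    (a n k - a n j) ^ 2 ≤ (c * Real.exp c * Real.exp c) ^ 2 / (n * √n) *
      Real.exp (-|(j : ℝ)| / (2 * n : ℝ)) := by
  obtain ⟨h1, h2⟩ := abs_a_sub_a_le hn h
  have hn' : (0 : ℝ) < n := by exact_mod_cast hn
  have hc : 0 ≤ c := (abs_nonneg _).trans h
  have hC : 0 ≤ c * Real.exp c * Real.exp c := by positivity
  have hE : Real.exp (-|(j : ℝ)| / n) = Real.exp (-|(j : ℝ)| / (2 * n : ℝ)) ^ 2 := by
    rw [← Real.exp_nat_mul]
    congr 1
    push_cast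
    field_simp
  rw [hE] at h2
  rw [← sq_abs]
  have hE0 := Real.exp_pos (-|(j : ℝ)| / (2 * n : ℝ))
  set E := Real.exp (-|(j : ℝ)| / (2 * n : ℝ))
  set C := c * Real.exp c * Real.exp c
  set D := |a n k - a n j|
  have hD : 0 ≤ D := abs_nonneg _
  refine le_of_pow_le_pow_left₀ two_ne_zero (by positivity) ?_
  calc (D ^ 2) ^ 2 = D ^ 3 * D := by ring
    _ ≤ (C / n) ^ 3 * (C * E ^ 2) := by gcongr
    _ = _ := by
      rw [mul_pow, div_pow, div_pow, mul_pow (n : ℝ), Real.sq_sqrt hn'.le]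
      field_simp

theorem a_pos (n : ℕ) (j : ℤ) : 0 < a n j := Real.exp_pos _

theorem a_le_one (n : ℕ) (j : ℤ) : a n j ≤ 1 :=
  Real.exp_le_one_iff.2 (mul_nonpos_of_nonpos_of_nonneg (by simp) (Real.exp_pos _).le)

theorem summable_half_log_one_add_a_sq {n : ℕ} (hn : 1 ≤ n) :
    Summable (fun j : ℤ => Real.log (1 + a n j ^ 2) / 2 - Real.log 2 / 2) := by
  have hn' : (0 : ℝ) < n := by exact_mod_cast hn
  refine Summable.of_norm_bounded ((summable_exp_neg_abs_div hn').mul_left (n : ℝ)) fun j => ?_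
  have hp := a_pos n j
  have h1 := a_le_one n j
  have hu : 1 - a n j ≤ n * Real.exp (-|(j : ℝ)| / n) := by
    have := Real.add_one_le_exp (-(n : ℝ) * Real.exp (-|(j : ℝ)| / n))
    rw [a]
    linarith
  have hle : Real.log (1 + a n j ^ 2) ≤ Real.log 2 :=
    Real.log_le_log (by positivity) (by nlinarith)
  have hlo := Real.one_sub_inv_le_log_of_pos (show 0 < (1 + a n j ^ 2) / 2 by positivity)
  rw [Real.log_div (by positivity) two_ne_zero, inv_div] at hlo
  have hfrac : 2 / (1 + a n j ^ 2) - 1 ≤ 2 * (1 - a n j) := by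
    rw [tsub_le_iff_right, div_le_iff₀ (by positivity)]
    nlinarith [mul_nonneg hp.le (sq_nonneg (1 - a n j)), mul_nonneg (sub_nonneg.2 h1) hp.le,
      sq_nonneg (1 - a n j), mul_nonneg (sub_nonneg.2 h1) (sq_nonneg (1 - a n j))]
  rw [Real.norm_eq_abs, abs_le]
  constructor
  · linarith
  · have : 0 ≤ n * Real.exp (-|(j : ℝ)| / n) := by positivity
    linarith

theorem abs_tsum_a_ratio_sub_one_le {g : Equiv.Perm ℤ} {c : ℝ} (hc : ∀ j : ℤ, |(g j : ℝ) - j| ≤ c)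
    {n : ℕ} (hn : 1 ≤ n) :
    |∑' j : ℤ, a n j ^ 2 / (1 + a n j ^ 2) * (a n (g j) / a n j - 1)|
      ≤ 6 * (c * Real.exp c * Real.exp c) ^ 2 / √n := by
  have hn' : (1 : ℝ) ≤ n := by exact_mod_cast hn
  have hn0 : (0 : ℝ) < 2 * n := by linarith
  set C := c * Real.exp c * Real.exp c
  let G : ℤ → ℝ := fun j => Real.log (1 + a n j ^ 2) / 2 - Real.log 2 / 2
  have hG : Summable G := summable_half_log_one_add_a_sq hn
  have hG0 : HasSum (fun j => G (g j) - G j) 0 := by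
    simpa using ((g.hasSum_iff (f := G)).2 hG.hasSum).sub hG.hasSum
  let R : ℤ → ℝ := fun j =>
    a n j ^ 2 / (1 + a n j ^ 2) * (a n (g j) / a n j - 1) - (G (g j) - G j)
  have hR : ∀ j, ‖R j‖ ≤ C ^ 2 / (n * √n) * Real.exp (-|(j : ℝ)| / (2 * n : ℝ)) := by
    intro j
    refine le_trans ?_ (sq_a_sub_a_le hn (hc j))
    have hp := a_pos n j
    have e : R j = a n j / (1 + a n j ^ 2) * (a n (g j) - a n j) -
        (Real.log (1 + a n (g j) ^ 2) / 2 - Real.log (1 + a n j ^ 2) / 2) := by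
      simp only [R, G]
      field_simp
      ring
    rw [e]
    exact abs_half_log_one_add_sq_sub_le _ _
  have hb := (summable_exp_neg_abs_div hn0).mul_left (C ^ 2 / (n * √n))
  have hRs : Summable R := Summable.of_norm_bounded hb hR
  have heq : ∑' j : ℤ, a n j ^ 2 / (1 + a n j ^ 2) * (a n (g j) / a n j - 1) = ∑' j, R j := by
    have h := hRs.hasSum.add hG0
    simp only [R, sub_add_cancel, add_zero] at h
    exact h.tsum_eq
  rw [heq]
  calc |∑' j, R j| ≤ ∑' j : ℤ, C ^ 2 / (n * √n) * Real.exp (-|(j : ℝ)| / (2 * n : ℝ)) :=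
        tsum_of_norm_bounded hb.hasSum hR
    _ ≤ C ^ 2 / (n * √n) * (6 * n) := by
        rw [tsum_mul_left]
        gcongr
        exact (tsum_exp_neg_abs_div_le hn0).trans (by linarith)
    _ = 6 * C ^ 2 / √n := by
        field_simp

theorem sum2_tendsto_zero (g : Equiv.Perm ℤ)
    (hg : ∃ c : ℝ, ∀ j : ℤ, |(g j : ℝ) - j| ≤ c) :
    Tendsto (fun n : ℕ =>
        ∑' j : ℤ, a n j ^ 2 / (1 + a n j ^ 2) * (a n (g j) / a n j - 1))
      atTop (nhds 0) := by
  obtain ⟨c, hc⟩ := hg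
  refine squeeze_zero_norm' ((eventually_ge_atTop 1).mono fun n hn => abs_tsum_a_ratio_sub_one_le hc hn) ?_
  exact (Real.tendsto_sqrt_atTop.comp tendsto_natCast_atTop_atTop).const_div_atTop _
end

section
/- For functions f_n(x) = exp(-n·Σ_{j∈ℤ} x_j e^{-|j|/n}) on the Bernoulli space {0,1}^ℤ and every bijection g of ℤ of bounded displacement, ⟨g·f_n, f_n⟩ / ‖f_n‖² → 1 as n → ∞. -/
open Filter MeasureTheory

/-- The density `f_n (x) = exp (-n ∑_j x_j e^{-|j|/n})` on the Bernoulli space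
`{0,1}^ℤ`, modelled as `ℤ → Bool`. -/
noncomputable def f (n : ℕ) (x : ℤ → Bool) : ℝ :=
  Real.exp (-(n : ℝ) * ∑' j : ℤ, (if x j then (1 : ℝ) else 0) * Real.exp (-|(j : ℝ)| / n))

/-- The exponential weight `exp (-∑_j x_j a_j)` on `{0,1}^ι`. -/
noncomputable def expWeight {ι : Type*} (a : ι → ℝ) (x : ι → Bool) : ℝ :=
  Real.exp (-∑' j, (if x j then a j else 0))

section Bernoulli

variable {ι : Type*} {μ : Measure (ι → Bool)}

/-- Under the symmetric Bernoulli measure, a finite product of functions of distinct coordinates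
integrates to the product of the averages. -/
lemma integral_prod_coord [IsProbabilityMeasure μ]
    (hμ : ∀ (s : Finset ι) (b : ι → Bool),
      μ {x | ∀ i ∈ s, x i = b i} = (1 / 2 : ENNReal) ^ s.card)
    (s : Finset ι) (h : ι → Bool → ℝ) :
    ∫ x, ∏ j ∈ s, h j (x j) ∂μ = ∏ j ∈ s, (h j true + h j false) / 2 := by
  classical
  have hmeas : Measurable (fun (x : ι → Bool) (j : s) => x j) := by fun_prop
  have hprob : IsProbabilityMeasure (μ.map fun (x : ι → Bool) (j : s) => x j) :=
    Measure.isProbabilityMeasure_map hmeas.aemeasurable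
  have hreal (b : s → Bool) :
      (μ.map fun (x : ι → Bool) (j : s) => x j).real {b} = (1 / 2) ^ s.card := by
    rw [map_measureReal_apply hmeas (measurableSet_singleton b)]
    have := hμ s fun i => if hi : i ∈ s then b ⟨i, hi⟩ else false
    have hset : ((fun (x : ι → Bool) (j : s) => x j) ⁻¹' {b}) =
        {x | ∀ i ∈ s, x i = if hi : i ∈ s then b ⟨i, hi⟩ else false} := by
      ext x
      simp only [Set.mem_preimage, Set.mem_singleton_iff, funext_iff, Subtype.forall,
        Set.mem_ofPred_eq]
      exact forall₂_congr fun i hi => by simp [hi]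
    rw [hset, measureReal_def, this]
    simp
  calc ∫ x, ∏ j ∈ s, h j (x j) ∂μ
      = ∫ x, (fun y : s → Bool => ∏ j : s, h j (y j)) (fun j : s => x j) ∂μ := by
        refine integral_congr_ae (ae_of_all _ fun x => ?_)
        exact (Finset.prod_coe_sort s fun j => h j (x j)).symm
    _ = ∫ y, ∏ j : s, h j (y j) ∂(μ.map fun (x : ι → Bool) (j : s) => x j) :=
        (integral_map hmeas.aemeasurable 
          (measurable_of_finite fun y : s → Bool => ∏ j : s, h j (y j)).aestronglyMeasurable).symm
    _ = ∑ y : s → Bool, (1 / 2 : ℝ) ^ s.card * ∏ j : s, h j (y j) := by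
        rw [integral_fintype .of_finite]
        simp only [hreal, smul_eq_mul]
    _ = ∏ j : s, (h j true + h j false) / 2 := by
        have := Finset.prod_univ_sum (fun _ : s => (Finset.univ : Finset Bool))
          (fun j b => h j b)
        simp only [Fintype.piFinset_univ] at this
        rw [← Finset.mul_sum, ← this]
        simp [div_eq_inv_mul, Finset.prod_mul_distrib]
    _ = _ := Finset.prod_coe_sort s fun j => (h j true + h j false) / 2

variable {a : ι → ℝ}

lemma summable_ite (ha : Summable a) (ha0 : ∀ j, 0 ≤ a j) (x : ι → Bool) :
    Summable fun j => if x j then a j else 0 :=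
  ha.of_nonneg_of_le (fun j => by split_ifs <;> simp [ha0]) fun j => by
    split_ifs <;> simp [ha0]

lemma tendsto_prod_expWeight (ha : Summable a) (ha0 : ∀ j, 0 ≤ a j) (x : ι → Bool) :
    Tendsto (fun s : Finset ι => ∏ j ∈ s, (if x j then Real.exp (-a j) else 1)) atTop
      (nhds (expWeight a x)) := by
  have := (Real.continuous_exp.tendsto _).comp (summable_ite ha ha0 x).hasSum.neg
  refine this.congr fun s => ?_
  simp only [Function.comp, Real.exp_sum]
  exact Finset.prod_congr rfl fun j _ => by split_ifs <;> simp

lemma measurable_expWeight [Countable ι] (ha : Summable a) (ha0 : ∀ j, 0 ≤ a j) :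
    Measurable (expWeight a) := by
  refine measurable_of_tendsto_metrizable' atTop (fun s : Finset ι => ?_)
    (tendsto_pi_nhds.2 (tendsto_prod_expWeight ha ha0))
  refine Finset.measurable_fun_prod s fun j _ => ?_
  exact (measurable_of_finite fun b : Bool => if b then Real.exp (-a j) else 1).comp
    (measurable_pi_apply j)

lemma expWeight_pos (x : ι → Bool) : 0 < expWeight a x := Real.exp_pos _

lemma expWeight_le_one (ha0 : ∀ j, 0 ≤ a j) (x : ι → Bool) : expWeight a x ≤ 1 := by
  refine Real.exp_le_one_iff.2 (neg_nonpos.2 (tsum_nonneg fun j => ?_))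
  split_ifs <;> simp [ha0]

lemma expWeight_mul {b : ι → ℝ} (ha : Summable a) (ha0 : ∀ j, 0 ≤ a j) (hb : Summable b)
    (hb0 : ∀ j, 0 ≤ b j) (x : ι → Bool) :
    expWeight a x * expWeight b x = expWeight (fun j => a j + b j) x := by
  rw [expWeight, expWeight, expWeight, ← Real.exp_add, ← neg_add,
    ← (summable_ite ha ha0 x).tsum_add (summable_ite hb hb0 x)]
  congr 3
  ext j
  split_ifs <;> simp

lemma expWeight_comp_perm (σ : Equiv.Perm ι) (x : ι → Bool) :
    expWeight a (fun j => x (σ j)) = expWeight (fun j => a (σ.symm j)) x := by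
  rw [expWeight, expWeight, ← σ.tsum_eq fun j => if x j then a (σ.symm j) else 0]
  simp

lemma integrable_expWeight [Countable ι] [IsProbabilityMeasure μ] (ha : Summable a)
    (ha0 : ∀ j, 0 ≤ a j) : Integrable (expWeight a) μ := by
  refine .of_bound (measurable_expWeight ha ha0).aestronglyMeasurable 1 (ae_of_all _ fun x => ?_)
  rw [Real.norm_of_nonneg (expWeight_pos x).le]
  exact expWeight_le_one ha0 x

lemma integral_expWeight_pos [Countable ι] [IsProbabilityMeasure μ] (ha : Summable a)
    (ha0 : ∀ j, 0 ≤ a j) : 0 < ∫ x, expWeight a x ∂μ := by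
  rw [integral_pos_iff_support_of_nonneg (fun x => (expWeight_pos x).le)
    (integrable_expWeight ha ha0)]
  have : Function.support (expWeight a) = Set.univ :=
    Set.eq_univ_of_forall fun x => (expWeight_pos x).ne'
  simp [this]

/-- The Bernoulli integral of an exponential weight is an infinite product. -/
lemma hasProd_integral_expWeight [Countable ι] [IsProbabilityMeasure μ]
    (hμ : ∀ (s : Finset ι) (b : ι → Bool),
      μ {x | ∀ i ∈ s, x i = b i} = (1 / 2 : ENNReal) ^ s.card)
    (ha : Summable a) (ha0 : ∀ j, 0 ≤ a j) :
    HasProd (fun j => (1 + Real.exp (-a j)) / 2) (∫ x, expWeight a x ∂μ) := by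
  have key : Tendsto (fun s : Finset ι =>
      ∫ x, ∏ j ∈ s, (if x j then Real.exp (-a j) else 1) ∂μ) atTop
      (nhds (∫ x, expWeight a x ∂μ)) := by
    refine tendsto_integral_filter_of_dominated_convergence (fun _ => 1)
      (.of_forall fun s => ?_) (.of_forall fun s => ae_of_all _ fun x => ?_)
      (integrable_const 1) (ae_of_all _ (tendsto_prod_expWeight ha ha0))
    · refine (Finset.measurable_fun_prod s fun j _ => ?_).aestronglyMeasurable
      exact (measurable_of_finite fun b : Bool => if b then Real.exp (-a j) else 1).comp
        (measurable_pi_apply j)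
    · rw [Real.norm_of_nonneg (Finset.prod_nonneg fun j _ => by split_ifs <;> positivity)]
      exact Finset.prod_le_one (fun j _ => by split_ifs <;> positivity)
        fun j _ => by split_ifs <;> simp [ha0]
  refine key.congr fun s => ?_
  rw [integral_prod_coord hμ s fun j b => if b then Real.exp (-a j) else 1]
  exact Finset.prod_congr rfl fun j _ => by simp [add_comm]

end Bernoulli

section Inequalities

lemma one_sub_sum_le_prod_one_sub {ι : Type*} (s : Finset ι) (d : ι → ℝ)
    (h0 : ∀ i, 0 ≤ d i) (h1 : ∀ i, d i ≤ 1) :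
    1 - ∑ i ∈ s, d i ≤ ∏ i ∈ s, (1 - d i) := by
  classical
  induction s using Finset.induction_on with
  | empty => simp
  | insert i s hi ih =>
    rw [Finset.sum_insert hi, Finset.prod_insert hi]
    have hS : 0 ≤ ∑ i ∈ s, d i := Finset.sum_nonneg fun i _ => h0 i
    nlinarith [h0 i, h1 i, mul_nonneg (h0 i) hS,
      mul_le_mul_of_nonneg_left ih (sub_nonneg.2 (h1 i))]

/-- A reverse Cauchy-Schwarz inequality for products of two-point averages. -/
lemma one_sub_mul_prod_le_prod_sq {ι : Type*} (s : Finset ι) (u v : ι → ℝ) {ε : ℝ}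
    (hε : ∑ i ∈ s, (u i - v i) ^ 2 ≤ ε) :
    (1 - ε) * ((∏ i ∈ s, (1 + u i * u i) / 2) * ∏ i ∈ s, (1 + v i * v i) / 2) ≤
      (∏ i ∈ s, (1 + u i * v i) / 2) ^ 2 := by
  have hpos (i : ι) : 0 < (1 + u i * u i) * (1 + v i * v i) := by
    nlinarith [mul_self_nonneg (u i), mul_self_nonneg (v i), mul_self_nonneg (u i * v i)]
  set d : ι → ℝ := fun i => (u i - v i) ^ 2 / ((1 + u i * u i) * (1 + v i * v i)) with hd
  have hd0 (i : ι) : 0 ≤ d i := div_nonneg (sq_nonneg _) (hpos i).le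
  have hd1 (i : ι) : d i ≤ 1 := by
    rw [hd, div_le_one (hpos i)]
    nlinarith [sq_nonneg (1 + u i * v i)]
  have hdle (i : ι) : d i ≤ (u i - v i) ^ 2 := by
    refine div_le_self (sq_nonneg _) ?_
    nlinarith [mul_self_nonneg (u i), mul_self_nonneg (v i), mul_self_nonneg (u i * v i)]
  have hprod : (∏ i ∈ s, (1 + u i * v i) / 2) ^ 2 = (∏ i ∈ s, (1 - d i)) *
      ((∏ i ∈ s, (1 + u i * u i) / 2) * ∏ i ∈ s, (1 + v i * v i) / 2) := by
    rw [← Finset.prod_pow, ← Finset.prod_mul_distrib, ← Finset.prod_mul_distrib]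
    refine Finset.prod_congr rfl fun i _ => ?_
    have := (hpos i).ne'
    have hdi : d i * ((1 + u i * u i) * (1 + v i * v i)) = (u i - v i) ^ 2 :=
      div_mul_cancel₀ _ this
    linear_combination (1 / 4) * hdi
  rw [hprod]
  refine mul_le_mul_of_nonneg_right ?_ (mul_nonneg ?_ ?_)
  · have := one_sub_sum_le_prod_one_sub s d hd0 hd1
    have := Finset.sum_le_sum fun i (_ : i ∈ s) => hdle i
    linarith
  · exact Finset.prod_nonneg fun i _ => by linarith [mul_self_nonneg (u i)]
  · exact Finset.prod_nonneg fun i _ => by linarith [mul_self_nonneg (v i)]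

lemma prod_sq_le_mul_prod {ι : Type*} (s : Finset ι) (u v : ι → ℝ) :
    (∏ i ∈ s, (1 + u i * v i) / 2) ^ 2 ≤
      (∏ i ∈ s, (1 + u i * u i) / 2) * ∏ i ∈ s, (1 + v i * v i) / 2 := by
  rw [← Finset.prod_pow, ← Finset.prod_mul_distrib]
  exact Finset.prod_le_prod (fun i _ => sq_nonneg _) fun i _ => by
    nlinarith [sq_nonneg (u i - v i)]

lemma sq_mul_exp_neg_le_sqrt {x : ℝ} (hx : 0 ≤ x) : (x * Real.exp (-x)) ^ 2 ≤ √x := by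
  have h0 : 0 ≤ x * Real.exp (-x) := by positivity
  rcases le_total x 1 with h | h
  · have h1 : x * Real.exp (-x) ≤ x :=
      mul_le_of_le_one_right hx (Real.exp_le_one_iff.2 (by linarith))
    have h2 : x ≤ √x := Real.le_sqrt_of_sq_le (by nlinarith)
    nlinarith
  · have h1 : x * Real.exp (-x) ≤ 1 := by
      rw [Real.exp_neg, ← div_eq_mul_inv, div_le_one (Real.exp_pos x)]
      linarith [Real.add_one_le_exp x]
    have h2 : 1 ≤ √x := Real.one_le_sqrt.2 h
    nlinarith

lemma sq_exp_neg_sub_exp_neg_le_of_le {a b δ : ℝ} (ha : 0 ≤ a) (hab : a ≤ b)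
    (hb : b - a ≤ a * δ) :
    (Real.exp (-a) - Real.exp (-b)) ^ 2 ≤ δ ^ 2 * √a := by
  have h1 : Real.exp (-b) ≤ Real.exp (-a) := Real.exp_le_exp.2 (by linarith)
  have h2 : Real.exp (-a) - Real.exp (-b) ≤ δ * (a * Real.exp (-a)) := by
    have h3 : Real.exp (-b) = Real.exp (-a) * Real.exp (-(b - a)) := by
      rw [← Real.exp_add]; ring_nf
    have h4 := mul_le_mul_of_nonneg_left (Real.add_one_le_exp (-(b - a))) (Real.exp_pos (-a)).le
    nlinarith [mul_le_mul_of_nonneg_left hb (Real.exp_pos (-a)).le]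
  calc (Real.exp (-a) - Real.exp (-b)) ^ 2 ≤ (δ * (a * Real.exp (-a))) ^ 2 :=
        pow_le_pow_left₀ (by linarith) h2 2
    _ = δ ^ 2 * (a * Real.exp (-a)) ^ 2 := by ring
    _ ≤ _ := mul_le_mul_of_nonneg_left (sq_mul_exp_neg_le_sqrt ha) (sq_nonneg δ)

lemma sq_exp_neg_sub_exp_neg_le {a b δ : ℝ} (ha : 0 ≤ a) (hb : 0 ≤ b)
    (hab : a ≤ b * (1 + δ)) (hba : b ≤ a * (1 + δ)) :
    (Real.exp (-a) - Real.exp (-b)) ^ 2 ≤ δ ^ 2 * (√a + √b) := by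
  rcases le_total a b with h | h
  · have := sq_exp_neg_sub_exp_neg_le_of_le ha h (δ := δ) (by linarith)
    nlinarith [mul_nonneg (sq_nonneg δ) (Real.sqrt_nonneg b)]
  · have := sq_exp_neg_sub_exp_neg_le_of_le hb h (δ := δ) (by linarith)
    nlinarith [mul_nonneg (sq_nonneg δ) (Real.sqrt_nonneg a)]

end Inequalities

section ExponentialProfile

lemma hasSum_exp_neg_mul_abs {t : ℝ} (ht : 0 < t) :
    HasSum (fun j : ℤ => Real.exp (-(t * |(j : ℝ)|)))
      ((1 - Real.exp (-t))⁻¹ + Real.exp (-t) * (1 - Real.exp (-t))⁻¹) := by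
  have hr : Real.exp (-t) < 1 := Real.exp_lt_one_iff.2 (by linarith)
  have hg := hasSum_geometric_of_lt_one (Real.exp_pos (-t)).le hr
  refine HasSum.of_nat_of_neg_add_one ?_ ?_
  · simpa [← Real.exp_nat_mul, mul_comm] using hg
  · refine (hg.mul_left (Real.exp (-t))).congr_fun fun k => ?_
    rw [← Real.exp_nat_mul, ← Real.exp_add]
    push_cast
    rw [abs_neg, abs_of_nonneg (by positivity)]
    ring_nf

lemma tsum_exp_neg_mul_abs_le {t : ℝ} (ht : 0 < t) :
    ∑' j : ℤ, Real.exp (-(t * |(j : ℝ)|)) ≤ 2 * (1 + 1 / t) := by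
  rw [(hasSum_exp_neg_mul_abs ht).tsum_eq]
  have hr : Real.exp (-t) < 1 := Real.exp_lt_one_iff.2 (by linarith)
  have hle : (1 - Real.exp (-t))⁻¹ ≤ 1 + 1 / t := by
    have h1 : Real.exp (-t) ≤ (1 + t)⁻¹ := by
      rw [Real.exp_neg]
      exact inv_anti₀ (by linarith) (by linarith [Real.add_one_le_exp t])
    have h2 : 1 + 1 / t = (1 - (1 + t)⁻¹)⁻¹ := by
      have : 1 + t ≠ 0 := by linarith
      have h : 1 - (1 + t)⁻¹ = t / (1 + t) := by field_simp; ring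
      rw [h, inv_div]; field_simp; ring
    rw [h2]
    refine inv_anti₀ ?_ (by linarith)
    have : (1 + t)⁻¹ < 1 := inv_lt_one_of_one_lt₀ (by linarith)
    linarith
  have h0 : 0 < (1 - Real.exp (-t))⁻¹ := inv_pos.2 (by linarith)
  nlinarith

/-- The weight `n e^{-|j|/n}` attached to the coordinate `j`. -/
noncomputable def profile (n : ℕ) (j : ℤ) : ℝ := n * Real.exp (-|(j : ℝ)| / n)

lemma profile_nonneg (n : ℕ) (j : ℤ) : 0 ≤ profile n j := by unfold profile; positivity

lemma f_eq_expWeight (n : ℕ) (x : ℤ → Bool) : f n x = expWeight (profile n) x := by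
  rw [f, expWeight, neg_mul, ← tsum_mul_left]
  congr 3
  ext j
  split_ifs <;> simp [profile]

variable {n : ℕ}

lemma summable_profile (hn : 0 < n) : Summable (profile n) := by
  have hn' : (0 : ℝ) < n := by exact_mod_cast hn
  refine ((hasSum_exp_neg_mul_abs (one_div_pos.2 hn')).summable.mul_left (n : ℝ)).congr
    fun j => ?_
  rw [profile]
  congr 2
  ring

lemma sqrt_profile (j : ℤ) :
    √(profile n j) = √n * Real.exp (-(1 / (2 * n) * |(j : ℝ)|)) := by
  rw [profile, Real.sqrt_mul (Nat.cast_nonneg n), ← Real.exp_half]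
  congr 2
  ring

lemma summable_sqrt_profile (hn : 0 < n) : Summable fun j => √(profile n j) := by
  have hn' : (0 : ℝ) < n := by exact_mod_cast hn
  simp only [sqrt_profile]
  exact (hasSum_exp_neg_mul_abs (by positivity)).summable.mul_left _

lemma tsum_sqrt_profile_le (hn : 0 < n) : ∑' j, √(profile n j) ≤ 6 * n * √n := by
  have hn' : (1 : ℝ) ≤ n := by exact_mod_cast hn
  simp only [sqrt_profile, tsum_mul_left]
  have := tsum_exp_neg_mul_abs_le (t := 1 / (2 * (n : ℝ))) (by positivity)
  rw [one_div_one_div] at this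
  nlinarith [Real.sqrt_nonneg (n : ℝ), mul_le_mul_of_nonneg_left this (Real.sqrt_nonneg (n : ℝ))]

lemma profile_le_mul {c : ℝ} (hn : 0 < n) (hc : 0 ≤ c) (hcn : c ≤ n) {i j : ℤ}
    (hij : |(i : ℝ) - j| ≤ c) : profile n i ≤ profile n j * (1 + 2 * c / n) := by
  have hn' : (0 : ℝ) < n := by exact_mod_cast hn
  have hle : Real.exp (c / n) ≤ 1 + 2 * c / n := by
    have h := Real.abs_exp_sub_one_le (x := c / n) (by
      rw [abs_of_nonneg (by positivity)]; exact (div_le_one hn').2 hcn)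
    rw [abs_of_nonneg (by positivity : 0 ≤ c / n)] at h
    have := le_of_abs_le h
    rw [mul_div_assoc]
    linarith
  have habs : |(j : ℝ)| - |(i : ℝ)| ≤ c :=
    (abs_sub_abs_le_abs_sub _ _).trans (by rwa [abs_sub_comm])
  calc profile n i ≤ n * (Real.exp (-|(j : ℝ)| / n) * Real.exp (c / n)) := by
        rw [profile, ← Real.exp_add, ← add_div]
        gcongr
        linarith
    _ = profile n j * Real.exp (c / n) := by rw [profile]; ring
    _ ≤ _ := mul_le_mul_of_nonneg_left hle (profile_nonneg n j)

end ExponentialProfile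

/-- The quantitative form of `inner_ratio_tendsto_one`. -/
lemma inner_ratio_sq_bounds
    {μ : Measure (ℤ → Bool)} [IsProbabilityMeasure μ]
    (hμ : ∀ (s : Finset ℤ) (b : ℤ → Bool),
      μ {x | ∀ i ∈ s, x i = b i} = (1 / 2 : ENNReal) ^ s.card)
    (g : Equiv.Perm ℤ) {c : ℝ} (hc : 0 ≤ c) (hg : ∀ j : ℤ, |(g j : ℝ) - j| ≤ c)
    {n : ℕ} (hn : 0 < n) (hcn : c ≤ n) :
    let r := (∫ x, f n (fun j => x (g j)) * f n x ∂μ) / ((eLpNorm (f n) 2 μ).toReal) ^ 2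
    0 ≤ r ∧ 1 - 48 * c ^ 2 / √n ≤ r ^ 2 ∧ r ^ 2 ≤ 1 := by
  intro r
  have hn' : (0 : ℝ) < n := by exact_mod_cast hn
  set a := profile n
  set b : ℤ → ℝ := fun j => a (g.symm j)
  have ha : Summable a := summable_profile hn
  have ha0 : ∀ j, 0 ≤ a j := profile_nonneg n
  have hb : Summable b := g.symm.summable_iff.2 ha
  have hb0 : ∀ j, 0 ≤ b j := fun j => ha0 _
  have hnum : ∫ x, f n (fun j => x (g j)) * f n x ∂μ =
      ∫ x, expWeight (fun j => a j + b j) x ∂μ := by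
    refine integral_congr_ae (ae_of_all _ fun x => ?_)
    simp only [f_eq_expWeight, expWeight_comp_perm]
    rw [mul_comm]
    exact expWeight_mul ha ha0 hb hb0 x
  have hden : ((eLpNorm (f n) 2 μ).toReal) ^ 2 = ∫ x, expWeight (fun j => a j + a j) x ∂μ := by
    have hf : f n = expWeight a := funext (f_eq_expWeight n)
    have hL : MemLp (f n) 2 μ := by
      rw [hf]
      refine .of_bound (measurable_expWeight ha ha0).aestronglyMeasurable 1
        (ae_of_all _ fun x => ?_)
      rw [Real.norm_of_nonneg (expWeight_pos x).le]
      exact expWeight_le_one ha0 x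
    rw [hL.eLpNorm_eq_integral_rpow_norm two_ne_zero ENNReal.ofNat_ne_top,
      ENNReal.toReal_ofReal (by positivity), ENNReal.toReal_ofNat, ← Real.rpow_natCast,
      ← Real.rpow_mul (integral_nonneg fun x => by positivity)]
    norm_num
    refine integral_congr_ae (ae_of_all _ fun x => ?_)
    simp only [f_eq_expWeight, sq]
    exact expWeight_mul ha ha0 ha ha0 x
  set A := ∫ x, expWeight (fun j => a j + a j) x ∂μ
  set B := ∫ x, expWeight (fun j => a j + b j) x ∂μ
  have hApos : 0 < A := integral_expWeight_pos (ha.add ha) fun j => add_nonneg (ha0 j) (ha0 j)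
  have hBpos : 0 < B := integral_expWeight_pos (ha.add hb) fun j => add_nonneg (ha0 j) (hb0 j)
  have hAprod := hasProd_integral_expWeight hμ (ha.add ha) fun j => add_nonneg (ha0 j) (ha0 j)
  have hBprod := hasProd_integral_expWeight hμ (ha.add hb) fun j => add_nonneg (ha0 j) (hb0 j)
  have hAprod' := g.symm.hasProd_iff.2 hAprod
  simp only [neg_add, Real.exp_add, Function.comp_def] at hAprod hBprod hAprod'
  have hε (s : Finset ℤ) :
      ∑ j ∈ s, (Real.exp (-a j) - Real.exp (-b j)) ^ 2 ≤ 48 * c ^ 2 / √n := by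
    have hsa := summable_sqrt_profile hn
    have hsb : Summable fun j => √(b j) := g.symm.summable_iff.2 hsa
    have hdisp (j : ℤ) : |(j : ℝ) - (g.symm j : ℤ)| ≤ c := by simpa using hg (g.symm j)
    calc ∑ j ∈ s, (Real.exp (-a j) - Real.exp (-b j)) ^ 2
        ≤ ∑ j ∈ s, (2 * c / n) ^ 2 * (√(a j) + √(b j)) :=
          Finset.sum_le_sum fun j _ => sq_exp_neg_sub_exp_neg_le (ha0 j) (hb0 j)
            (profile_le_mul hn hc hcn (hdisp j))
            (profile_le_mul hn hc hcn (by rw [abs_sub_comm]; exact hdisp j))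
      _ = (2 * c / n) ^ 2 * ∑ j ∈ s, (√(a j) + √(b j)) := by rw [Finset.mul_sum]
      _ ≤ (2 * c / n) ^ 2 * (6 * n * √n + 6 * n * √n) := by
          refine mul_le_mul_of_nonneg_left ?_ (sq_nonneg _)
          refine ((hsa.add hsb).sum_le_tsum s fun j _ => by positivity).trans ?_
          rw [hsa.tsum_add hsb, g.symm.tsum_eq fun j => √(a j)]
          exact add_le_add (tsum_sqrt_profile_le hn) (tsum_sqrt_profile_le hn)
      _ = 48 * c ^ 2 / √n := by
          have : √(n : ℝ) * √n = n := Real.mul_self_sqrt hn'.le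
          have h0 : √(n : ℝ) ≠ 0 := (Real.sqrt_pos.2 hn').ne'
          rw [eq_div_iff h0]
          field_simp
          linear_combination (48 * c ^ 2) * this
  have hlower : (1 - 48 * c ^ 2 / √n) * (A * A) ≤ B ^ 2 :=
    le_of_tendsto_of_tendsto' ((Tendsto.mul hAprod hAprod').const_mul _) (Tendsto.pow hBprod 2)
      fun s => one_sub_mul_prod_le_prod_sq s _ _ (hε s)
  have hupper : B ^ 2 ≤ A * A :=
    le_of_tendsto_of_tendsto' (Tendsto.pow hBprod 2) (Tendsto.mul hAprod hAprod')
      fun s => prod_sq_le_mul_prod s _ _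
  have hr : r = B / A := by simp only [r, hnum, hden]
  have hA2 : 0 < A * A := mul_pos hApos hApos
  rw [hr, div_pow, sq A]
  exact ⟨(div_pos hBpos hApos).le, (le_div_iff₀ hA2).2 hlower, (div_le_one hA2).2 hupper⟩

theorem inner_ratio_tendsto_one
    (μ : Measure (ℤ → Bool)) [IsProbabilityMeasure μ]
    (hμ : ∀ (s : Finset ℤ) (b : ℤ → Bool),
      μ {x | ∀ i ∈ s, x i = b i} = (1 / 2 : ENNReal) ^ s.card)
    (g : Equiv.Perm ℤ) (hg : ∃ c : ℝ, ∀ j : ℤ, |(g j : ℝ) - j| ≤ c) :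
    Tendsto (fun n : ℕ =>
        (∫ x, f n (fun j => x (g j)) * f n x ∂μ) / ((eLpNorm (f n) 2 μ).toReal) ^ 2)
      atTop (nhds 1) := by
  obtain ⟨c, hg⟩ := hg
  have hc : 0 ≤ c := (abs_nonneg _).trans (hg 0)
  have hev : ∀ᶠ n : ℕ in atTop, 0 < n ∧ c ≤ n :=
    (eventually_gt_atTop 0).and (tendsto_natCast_atTop_atTop.eventually_ge_atTop c)
  have hlim : Tendsto (fun n : ℕ => 1 - 48 * c ^ 2 / √(n : ℝ)) atTop (nhds 1) := by
    have h := (Real.tendsto_sqrt_atTop.comp (tendsto_natCast_atTop_atTop (R := ℝ))).const_div_atTop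
      (48 * c ^ 2)
    simpa [Function.comp_def] using h.const_sub 1
  refine tendsto_of_tendsto_of_tendsto_of_le_of_le' hlim tendsto_const_nhds ?_ ?_
  · filter_upwards [hev] with n hn
    obtain ⟨h0, h1, h2⟩ := inner_ratio_sq_bounds hμ g hc hg hn.1 hn.2
    nlinarith [(sq_le_one_iff₀ h0).1 h2]
  · filter_upwards [hev] with n hn
    obtain ⟨h0, -, h2⟩ := inner_ratio_sq_bounds hμ g hc hg hn.1 hn.2
    exact (sq_le_one_iff₀ h0).1 h2
end
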